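/- arXiv:1807.02243 — 4 statements merged into one kernel-verified Lean document; each statement's English description precedes it below -/
import Mathlib

section
/- Let X be a continuous martingale (not necessarily nonnegative) started at the deterministic value X_0 = x₀, with running maximum M_T = sup_{0 ≤ s ≤ T} X_s. Assume the integrability condition ∫_0^T M_t^2 d[X,X]_t < ∞ almost surely (and that X_T M_T and M_T^2 are integrable). Then E[X_T · M_T] = (1/2) · E[M_T^2] + (1/2) · x₀^2. -/
open MeasureTheory Filter Set
open scoped Topology

/-- The running maximum of `f` along the grid `i * T / (n + 1)`, `i = 0, 1, 2, …`. -/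
noncomputable def gridMax (f : ℝ → ℝ) (T : ℝ) (n : ℕ) : ℕ → ℝ :=
  partialSups fun i : ℕ => f (i * T / (n + 1))

namespace gridMax

variable {f : ℝ → ℝ} {T : ℝ} {n : ℕ}

lemma zero : gridMax f T n 0 = f 0 := by simp [gridMax]

lemma succ (i : ℕ) : gridMax f T n (i + 1) =
    max (gridMax f T n i) (f ((i + 1 : ℕ) * T / (n + 1))) := by
  simp [gridMax, partialSups_add_one]

lemma mono : Monotone (gridMax f T n) := (partialSups _).monotone

lemma le_self (i : ℕ) : f (i * T / (n + 1)) ≤ gridMax f T n i :=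
  le_partialSups (fun i : ℕ => f (i * T / (n + 1))) i

lemma init_le (i : ℕ) : f 0 ≤ gridMax f T n i := by
  rw [← zero (f := f) (T := T) (n := n)]
  exact mono (Nat.zero_le i)

lemma grid_mem_Icc (hT : 0 < T) {i : ℕ} (hi : i ≤ n + 1) :
    (i * T / (n + 1) : ℝ) ∈ Icc 0 T := by
  have hi' : (i : ℝ) ≤ n + 1 := by exact_mod_cast hi
  refine ⟨by positivity, ?_⟩
  rw [div_le_iff₀ (by positivity)]
  nlinarith

lemma le_iSup (hf : Continuous f) (hT : 0 < T) {i : ℕ} (hi : i ≤ n + 1) :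
    gridMax f T n i ≤ ⨆ s : Icc (0 : ℝ) T, f s := by
  refine partialSups_le _ _ _ fun j hj => ?_
  have hb : BddAbove (range fun s : Icc (0 : ℝ) T => f s) :=
    (isCompact_range (by fun_prop)).bddAbove
  exact le_ciSup hb ⟨_, grid_mem_Icc hT (hj.trans hi)⟩

lemma eventually_dist_lt (hf : Continuous f) {ε : ℝ} (hε : 0 < ε) :
    ∀ᶠ n : ℕ in atTop, ∀ s ∈ Icc (0 : ℝ) T, ∀ t ∈ Icc (0 : ℝ) T,
      |s - t| ≤ T / (n + 1) → |f s - f t| < ε := by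
  obtain ⟨δ, hδ, h⟩ := Metric.uniformContinuousOn_iff.1
    (isCompact_Icc.uniformContinuousOn_of_continuous (hf.continuousOn (s := Icc 0 T))) ε hε
  have hlim : Tendsto (fun n : ℕ => T / ((n : ℝ) + 1)) atTop (𝓝 0) := by
    simpa [div_eq_mul_inv] using (tendsto_one_div_add_atTop_nhds_zero_nat (𝕜 := ℝ)).const_mul T
  filter_upwards [hlim.eventually_lt_const hδ] with n hn s hs t ht hst
  exact h s hs t ht (hst.trans_lt hn)

lemma tendsto_iSup (hf : Continuous f) (hT : 0 < T) :
    Tendsto (fun n : ℕ => gridMax f T n (n + 1)) atTop (𝓝 (⨆ s : Icc (0 : ℝ) T, f s)) := by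
  rw [Metric.tendsto_atTop']
  intro ε hε
  obtain ⟨N, hN⟩ := eventually_atTop.1 (eventually_dist_lt hf (half_pos hε))
  refine ⟨N, fun n hn => ?_⟩
  have : Nonempty (Icc (0 : ℝ) T) := ⟨⟨0, le_rfl, hT.le⟩⟩
  have hle : (⨆ s : Icc (0 : ℝ) T, f s) ≤ gridMax f T n (n + 1) + ε / 2 := by
    refine ciSup_le fun ⟨s, hs0, hsT⟩ => ?_
    have hn0 : (0 : ℝ) < n + 1 := by positivity
    set i := ⌊s * (n + 1) / T⌋₊
    have h1 : (i : ℝ) ≤ s * (n + 1) / T := Nat.floor_le (by positivity)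
    have h2 : s * (n + 1) / T < i + 1 := Nat.lt_floor_add_one _
    rw [le_div_iff₀ hT] at h1
    rw [div_lt_iff₀ hT] at h2
    have hi : i ≤ n + 1 := by
      have : (i : ℝ) ≤ (n : ℝ) + 1 := by nlinarith
      exact_mod_cast this
    have hdist : |s - i * T / (n + 1)| ≤ T / (n + 1) := by
      rw [abs_le]
      constructor
      · have h3 : i * T / (n + 1) ≤ s := (div_le_iff₀ hn0).2 h1
        have h4 : 0 ≤ T / (n + 1) := by positivity
        linarith
      · rw [sub_le_iff_le_add, ← add_div, le_div_iff₀ hn0]; nlinarith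
    have h3 := (abs_lt.1 (hN n hn.le s ⟨hs0, hsT⟩ _ (grid_mem_Icc hT hi) hdist)).2
    have h4 := le_self (f := f) (T := T) (n := n) i
    have h5 : gridMax f T n i ≤ gridMax f T n (n + 1) := mono hi
    simp only
    linarith
  have := le_iSup (n := n) hf hT le_rfl
  rw [Real.dist_eq, abs_lt]
  constructor <;> linarith

lemma tendsto_sum_sq (hf : Continuous f) (hT : 0 < T) :
    Tendsto (fun n : ℕ => ∑ i ∈ Finset.range (n + 1),
      (gridMax f T n (i + 1) - gridMax f T n i) ^ 2) atTop (𝓝 0) := by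
  rw [Metric.tendsto_atTop']
  intro ε hε
  set K := (⨆ s : Icc (0 : ℝ) T, f s) - f 0
  have hK : 0 ≤ K := sub_nonneg.2
    ((init_le (n := 0) 0).trans (le_iSup hf hT (Nat.zero_le _)))
  have hη : 0 < ε / (K + 1) := by positivity
  obtain ⟨N, hN⟩ := eventually_atTop.1 (eventually_dist_lt hf hη)
  refine ⟨N, fun n hn => ?_⟩
  have hstep : ∀ i ∈ Finset.range (n + 1), (gridMax f T n (i + 1) - gridMax f T n i) ^ 2 ≤
      ε / (K + 1) * (gridMax f T n (i + 1) - gridMax f T n i) := by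
    intro i hi
    have hi : i + 1 ≤ n + 1 := Finset.mem_range.1 hi
    have h0 : gridMax f T n i ≤ gridMax f T n (i + 1) := mono (Nat.le_succ i)
    have h1 := (abs_lt.1 (hN n hn.le _ (grid_mem_Icc hT hi) _
      (grid_mem_Icc hT (i.le_succ.trans hi)) (by
        rw [abs_le]; push_cast
        have : (0 : ℝ) < T / (n + 1) := by positivity
        have h : ((i : ℝ) + 1) * T / (n + 1) - i * T / (n + 1) = T / (n + 1) := by ring
        rw [h]; constructor <;> linarith))).2
    have h2 := le_self (f := f) (T := T) (n := n) i
    have h3 : gridMax f T n (i + 1) ≤ gridMax f T n i + ε / (K + 1) := by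
      rw [succ]
      exact max_le (by linarith) (by linarith)
    nlinarith
  have hsum := Finset.sum_le_sum hstep
  rw [← Finset.mul_sum, Finset.sum_range_sub, zero] at hsum
  have hle := le_iSup (n := n) hf hT le_rfl
  have hmul : ε / (K + 1) * (gridMax f T n (n + 1) - f 0) ≤ ε / (K + 1) * K := by
    gcongr
    exact sub_le_sub_right hle _
  have hlt : ε / (K + 1) * K < ε := by
    rw [div_mul_eq_mul_div, div_lt_iff₀ (by positivity)]; nlinarith
  have hnn : 0 ≤ ∑ i ∈ Finset.range (n + 1),
      (gridMax f T n (i + 1) - gridMax f T n i) ^ 2 := Finset.sum_nonneg fun _ _ => sq_nonneg _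
  rw [Real.dist_eq, sub_zero, abs_of_nonneg hnn]
  linarith

lemma tendsto_sum_mul (hf : Continuous f) (hT : 0 < T) :
    Tendsto (fun n : ℕ => ∑ i ∈ Finset.range (n + 1),
      gridMax f T n (i + 1) * (gridMax f T n (i + 1) - gridMax f T n i)) atTop
      (𝓝 (((⨆ s : Icc (0 : ℝ) T, f s) ^ 2 - f 0 ^ 2) / 2)) := by
  have h := ((((tendsto_iSup hf hT).pow 2).sub_const (f 0 ^ 2)).add
    (tendsto_sum_sq hf hT)).div_const 2
  rw [add_zero] at h
  refine h.congr fun n => ?_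
  have : gridMax f T n (n + 1) ^ 2 - f 0 ^ 2 = ∑ i ∈ Finset.range (n + 1),
      (gridMax f T n (i + 1) ^ 2 - gridMax f T n i ^ 2) := by
    rw [Finset.sum_range_sub (fun i => gridMax f T n i ^ 2), zero]
  rw [this, ← Finset.sum_add_distrib, Finset.sum_div]
  exact Finset.sum_congr rfl fun i _ => by ring

/-- The increments of `gridMax f T n` truncated at the level `n + |f 0|`. -/
noncomputable def truncIncr (f : ℝ → ℝ) (T : ℝ) (n i : ℕ) : ℝ :=
  min (gridMax f T n (i + 1)) (n + |f 0|) - min (gridMax f T n i) (n + |f 0|)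

lemma truncIncr_nonneg (i : ℕ) : 0 ≤ truncIncr f T n i :=
  sub_nonneg.2 (min_le_min_right _ (mono i.le_succ))

lemma sum_truncIncr : ∑ i ∈ Finset.range (n + 1), truncIncr f T n i =
    min (gridMax f T n (n + 1)) (n + |f 0|) - f 0 := by
  unfold truncIncr
  have h1 := le_abs_self (f 0)
  have h2 : (0 : ℝ) ≤ n := by positivity
  rw [Finset.sum_range_sub (fun i => min (gridMax f T n i) (n + |f 0|)), zero,
    min_eq_left (by linarith : f 0 ≤ n + |f 0|)]

lemma sum_truncIncr_le (hf : Continuous f) (hT : 0 < T) :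
    ∑ i ∈ Finset.range (n + 1), truncIncr f T n i ≤ (⨆ s : Icc (0 : ℝ) T, f s) - f 0 := by
  rw [sum_truncIncr]
  exact sub_le_sub_right ((min_le_left _ _).trans (le_iSup hf hT le_rfl)) _

lemma abs_truncIncr_le (i : ℕ) : |truncIncr f T n i| ≤ n + 2 * |f 0| := by
  rw [abs_of_nonneg (truncIncr_nonneg i), truncIncr]
  have h1 := min_le_right (gridMax f T n (i + 1)) (n + |f 0|)
  have h2 : -|f 0| ≤ min (gridMax f T n i) (n + |f 0|) :=
    le_min ((neg_abs_le _).trans (init_le i)) (by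
      have := abs_nonneg (f 0)
      have : (0 : ℝ) ≤ n := by positivity
      linarith)
  linarith

/-- The running maximum only increases when the function is at its running maximum. -/
lemma mul_truncIncr (i : ℕ) : f ((i + 1 : ℕ) * T / (n + 1)) * truncIncr f T n i =
    gridMax f T n (i + 1) * truncIncr f T n i := by
  rcases le_total (gridMax f T n i) (f ((i + 1 : ℕ) * T / (n + 1))) with h | h
  · rw [succ, max_eq_right h]
  · rw [truncIncr, succ, max_eq_left h, sub_self, mul_zero, mul_zero]

lemma eventually_truncIncr_eq (hf : Continuous f) (hT : 0 < T) :
    ∀ᶠ n : ℕ in atTop, ∀ i ∈ Finset.range (n + 1),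
      truncIncr f T n i = gridMax f T n (i + 1) - gridMax f T n i := by
  filter_upwards [(tendsto_natCast_atTop_atTop (R := ℝ)).eventually_ge_atTop
    (⨆ s : Icc (0 : ℝ) T, f s)] with n hn i hi
  have hi : i + 1 ≤ n + 1 := Finset.mem_range.1 hi
  have h0 := abs_nonneg (f 0)
  have h1 := le_iSup hf hT hi
  have h2 := le_iSup hf hT (i.le_succ.trans hi)
  rw [truncIncr, min_eq_left (by linarith), min_eq_left (by linarith)]

lemma tendsto_sum_truncIncr (hf : Continuous f) (hT : 0 < T) :
    Tendsto (fun n : ℕ => ∑ i ∈ Finset.range (n + 1), truncIncr f T n i) atTop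
      (𝓝 ((⨆ s : Icc (0 : ℝ) T, f s) - f 0)) := by
  refine ((tendsto_iSup hf hT).sub_const (f 0)).congr' ?_
  filter_upwards [eventually_truncIncr_eq hf hT] with n hn
  rw [Finset.sum_congr rfl hn, Finset.sum_range_sub, zero]

lemma tendsto_sum_mul_truncIncr (hf : Continuous f) (hT : 0 < T) :
    Tendsto (fun n : ℕ => ∑ i ∈ Finset.range (n + 1),
      f ((i + 1 : ℕ) * T / (n + 1)) * truncIncr f T n i) atTop
      (𝓝 (((⨆ s : Icc (0 : ℝ) T, f s) ^ 2 - f 0 ^ 2) / 2)) := by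
  refine (tendsto_sum_mul hf hT).congr' ?_
  filter_upwards [eventually_truncIncr_eq hf hT] with n hn
  exact Finset.sum_congr rfl fun i hi => by rw [mul_truncIncr, hn i hi]

lemma abs_sum_truncIncr_le (hf : Continuous f) (hT : 0 < T) :
    |∑ i ∈ Finset.range (n + 1), truncIncr f T n i| ≤ |⨆ s : Icc (0 : ℝ) T, f s| + |f 0| := by
  rw [abs_of_nonneg (Finset.sum_nonneg fun i _ => truncIncr_nonneg i)]
  have := sum_truncIncr_le (n := n) hf hT
  have := le_abs_self (⨆ s : Icc (0 : ℝ) T, f s)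
  have := neg_abs_le (f 0)
  linarith

lemma abs_sum_mul_truncIncr_le (hf : Continuous f) (hT : 0 < T) :
    |∑ i ∈ Finset.range (n + 1), f ((i + 1 : ℕ) * T / (n + 1)) * truncIncr f T n i| ≤
      2 * (⨆ s : Icc (0 : ℝ) T, f s) ^ 2 + 2 * f 0 ^ 2 := by
  set S := ⨆ s : Icc (0 : ℝ) T, f s
  calc _ ≤ ∑ i ∈ Finset.range (n + 1), (|S| + |f 0|) * truncIncr f T n i := by
        refine (Finset.abs_sum_le_sum_abs _ _).trans (Finset.sum_le_sum fun i hi => ?_)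
        rw [mul_truncIncr, abs_mul, abs_of_nonneg (truncIncr_nonneg i)]
        refine mul_le_mul_of_nonneg_right ?_ (truncIncr_nonneg i)
        have h1 := le_iSup hf hT (Finset.mem_range.1 hi : i + 1 ≤ n + 1)
        have h2 := init_le (f := f) (T := T) (n := n) (i + 1)
        have := le_abs_self S
        have := neg_abs_le (f 0)
        have := abs_nonneg S
        have := abs_nonneg (f 0)
        rw [abs_le]
        constructor <;> linarith
    _ ≤ (|S| + |f 0|) * (|S| + |f 0|) := by
        rw [← Finset.mul_sum]
        exact mul_le_mul_of_nonneg_left ((le_abs_self _).trans (abs_sum_truncIncr_le hf hT))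
          (by positivity)
    _ ≤ _ := by
        rw [← sq_abs S, ← sq_abs (f 0)]
        nlinarith [sq_nonneg (|S| - |f 0|)]

end gridMax

/-- Tested against bounded variables known at time `s`, a martingale has the same expectation
at all times after `s`. -/
lemma MeasureTheory.Martingale.integral_mul_eq {Ω : Type*} {m0 : MeasurableSpace Ω}
    {μ : Measure Ω} [IsFiniteMeasure μ] {ℱ : Filtration ℝ m0} {X : ℝ → Ω → ℝ}
    (hX : Martingale X ℱ μ) {s t : ℝ} (hst : s ≤ t) {Z : Ω → ℝ}
    (hZ : StronglyMeasurable[ℱ s] Z) {C : ℝ} (hC : ∀ ω, |Z ω| ≤ C) :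
    ∫ ω, X t ω * Z ω ∂μ = ∫ ω, X s ω * Z ω ∂μ := by
  have hint : Integrable (X t * Z) μ :=
    (hX.integrable t).mul_bdd (hZ.mono (ℱ.le s)).aestronglyMeasurable
      (Eventually.of_forall hC)
  calc ∫ ω, X t ω * Z ω ∂μ = ∫ ω, (μ[X t * Z | ℱ s]) ω ∂μ := (integral_condExp (ℱ.le s)).symm
    _ = _ := integral_congr_ae <| by
      filter_upwards [condExp_mul_of_stronglyMeasurable_right hZ hint (hX.integrable t),
        hX.condExp_ae_eq hst] with ω h1 h2
      rw [h1, Pi.mul_apply, h2]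

lemma stronglyMeasurable_gridMax {Ω : Type*} {m : MeasurableSpace Ω} {X : ℝ → Ω → ℝ} {T : ℝ}
    {n i : ℕ} (h : ∀ j ≤ i, StronglyMeasurable (X (j * T / (n + 1)))) :
    StronglyMeasurable fun ω => gridMax (fun t => X t ω) T n i := by
  induction i with
  | zero => simpa [gridMax] using h 0 le_rfl
  | succ i ih =>
    simp only [gridMax.succ]
    exact (ih fun j hj => h j (hj.trans i.le_succ)).sup (h (i + 1) le_rfl)

/-- Let `X` be a continuous martingale (not necessarily nonnegative) started at the
deterministic value `x₀`, with running maximum `M t = ⨆ s ∈ [0, t], X s`, and let `A`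
be the quadratic variation process `[X,X]`.  Assume `∫_0^T M_t ^ 2 d[X,X]_t < ∞`
almost surely, and that `X_T * M_T` and `M_T ^ 2` are integrable.  Then
`E[X_T * M_T] = (1/2) * E[M_T ^ 2] + (1/2) * x₀ ^ 2`. -/
theorem identity_max_martingale_p_one
    {Ω : Type*} {m0 : MeasurableSpace Ω} {μ : Measure Ω} [IsProbabilityMeasure μ]
    (ℱ : Filtration ℝ m0) (X : ℝ → Ω → ℝ)
    (hX : Martingale X ℱ μ)
    (hXcont : ∀ ω, Continuous fun t => X t ω)
    (x₀ : ℝ) (hX0 : ∀ ω, X 0 ω = x₀)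
    (T : ℝ) (hT : 0 < T)
    (M : ℝ → Ω → ℝ) (hM : ∀ t ω, M t ω = ⨆ s : Set.Icc (0 : ℝ) t, X (s : ℝ) ω)
    -- `A` is the quadratic variation `[X,X]` of `X`:
    (A : ℝ → Ω → ℝ)
    (hAmono : ∀ ω, Monotone fun t => A t ω)
    (hAcont : ∀ ω, Continuous fun t => A t ω)
    (hAqv : ∀ t : ℝ, 0 ≤ t → TendstoInMeasure μ
      (fun n ω => ∑ i ∈ Finset.range (2 ^ n),
        (X (((i : ℝ) + 1) * t / 2 ^ n) ω - X ((i : ℝ) * t / 2 ^ n) ω) ^ 2)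
      atTop (fun ω => A t ω))
    -- `∫_0^T M_t ^ 2 d[X,X]_t < ∞` almost surely:
    (hfin : ∀ᵐ ω ∂μ, ∫⁻ t in Set.Ioc (0 : ℝ) T, ENNReal.ofReal (M t ω ^ 2)
      ∂(StieltjesFunction.measure
        ⟨fun t => A t ω, hAmono ω, fun _ => (hAcont ω).continuousWithinAt⟩) < ⊤)
    (hint₁ : Integrable (fun ω => X T ω * M T ω) μ)
    (hint₂ : Integrable (fun ω => M T ω ^ 2) μ) :
    ∫ ω, X T ω * M T ω ∂μ
      = (1 / 2) * ∫ ω, M T ω ^ 2 ∂μ + (1 / 2) * x₀ ^ 2 := by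
  obtain rfl : M = fun t ω => ⨆ s : Icc (0 : ℝ) t, X s ω := funext₂ hM
  clear hfin hAqv hAcont hAmono
  set Δ : ℕ → ℕ → Ω → ℝ := fun n i ω => gridMax.truncIncr (fun t => X t ω) T n i
  set τ : ℕ → ℕ → ℝ := fun n i => (i + 1 : ℕ) * T / (n + 1)
  have hΔmeas : ∀ n i, StronglyMeasurable[ℱ (τ n i)] (Δ n i) := by
    intro n i
    have hmeas : ∀ k ≤ i + 1, StronglyMeasurable[ℱ (τ n i)]
        fun ω => gridMax (fun t => X t ω) T n k := by
      intro k hk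
      refine stronglyMeasurable_gridMax fun j hj => (hX.stronglyAdapted _).mono (ℱ.mono ?_)
      simp only [τ]
      gcongr
      exact hj.trans hk
    simp only [Δ, gridMax.truncIncr, hX0]
    have hmin : ∀ k ≤ i + 1, StronglyMeasurable[ℱ (τ n i)]
        fun ω => min (gridMax (fun t => X t ω) T n k) (n + |x₀|) := fun k hk =>
      (continuous_id.min continuous_const).comp_stronglyMeasurable (hmeas k hk)
    exact (hmin _ le_rfl).sub (hmin _ i.le_succ)
  have hΔbdd : ∀ n i ω, |Δ n i ω| ≤ n + 2 * |x₀| := fun n i ω => by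
    simpa [hX0] using gridMax.abs_truncIncr_le (f := fun t => X t ω) (T := T) (n := n) i
  have hint : ∀ t n i, Integrable (fun ω => X t ω * Δ n i ω) μ := fun t n i =>
    (hX.integrable t).mul_bdd ((hΔmeas n i).mono (ℱ.le _)).aestronglyMeasurable
      (Eventually.of_forall (hΔbdd n i))
  have hdiscrete : ∀ n, ∫ ω, X T ω * ∑ i ∈ Finset.range (n + 1), Δ n i ω ∂μ =
      ∫ ω, ∑ i ∈ Finset.range (n + 1), X (τ n i) ω * Δ n i ω ∂μ := by
    intro n
    simp only [Finset.mul_sum]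
    rw [integral_finsetSum _ fun i _ => hint T n i,
      integral_finsetSum _ fun i _ => hint (τ n i) n i]
    exact Finset.sum_congr rfl fun i hi => hX.integral_mul_eq
      (gridMax.grid_mem_Icc hT (Finset.mem_range.1 hi : i + 1 ≤ n + 1)).2 (hΔmeas n i) (hΔbdd n i)
  have hlhs := tendsto_integral_of_dominated_convergence
    (F := fun n ω => X T ω * ∑ i ∈ Finset.range (n + 1), Δ n i ω)
    (f := fun ω => X T ω * ((⨆ s : Icc (0 : ℝ) T, X s ω) - x₀))
    (fun ω => |X T ω * ⨆ s : Icc (0 : ℝ) T, X s ω| + |X T ω| * |x₀|) (μ := μ)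
    (fun n => by
      simp only [Finset.mul_sum]
      exact (integrable_finsetSum _ fun i _ => hint T n i).aestronglyMeasurable)
    (hint₁.abs.add ((hX.integrable T).abs.mul_const _))
    (fun n => Eventually.of_forall fun ω => by
      have := gridMax.abs_sum_truncIncr_le (n := n) (hXcont ω) hT
      rw [hX0] at this
      rw [Real.norm_eq_abs, abs_mul, abs_mul, ← mul_add]
      exact mul_le_mul_of_nonneg_left this (abs_nonneg _))
    (Eventually.of_forall fun ω => by
      have := gridMax.tendsto_sum_truncIncr (hXcont ω) hT
      rw [hX0] at this
      exact this.const_mul _)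
  have hrhs := tendsto_integral_of_dominated_convergence
    (F := fun n ω => ∑ i ∈ Finset.range (n + 1), X (τ n i) ω * Δ n i ω)
    (f := fun ω => ((⨆ s : Icc (0 : ℝ) T, X s ω) ^ 2 - x₀ ^ 2) / 2)
    (fun ω => 2 * (⨆ s : Icc (0 : ℝ) T, X s ω) ^ 2 + 2 * x₀ ^ 2) (μ := μ)
    (fun n => (integrable_finsetSum _ fun i _ => hint (τ n i) n i).aestronglyMeasurable)
    ((hint₂.const_mul 2).add (integrable_const _))
    (fun n => Eventually.of_forall fun ω => by
      have := gridMax.abs_sum_mul_truncIncr_le (n := n) (hXcont ω) hT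
      rwa [hX0] at this)
    (Eventually.of_forall fun ω => by
      have := gridMax.tendsto_sum_mul_truncIncr (hXcont ω) hT
      rwa [hX0] at this)
  have hlim := tendsto_nhds_unique (hlhs.congr hdiscrete) hrhs
  have hmean : ∫ ω, X T ω ∂μ = x₀ := by
    have := hX.integral_mul_eq hT.le (Z := fun _ => 1) stronglyMeasurable_const (C := 1) (by simp)
    simpa [hX0] using this
  simp only [mul_sub] at hlim
  rw [integral_sub hint₁ ((hX.integrable T).mul_const _), integral_mul_const, hmean,
    integral_div, integral_sub hint₂ (integrable_const _)] at hlim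
  simp only [integral_const, probReal_univ, one_smul] at hlim
  simp only
  linarith
end

section
/- Let X be a nonnegative continuous sub-martingale started at the deterministic value X_0 = x₀ ≥ 0, with running maximum M_T = sup_{0 ≤ s ≤ T} X_s. Fix p > 0 and assume the integrability condition ∫_0^T M_t^{2p} d[X,X]_t < ∞ almost surely (and that X_T^{p+1} and M_T^{p+1} are integrable). Then the strengthened Doob maximal inequality E[M_T^{p+1}] + ((p+1)/p) · x₀^{p+1} ≤ ((p+1)/p)^{p+1} · E[X_T^{p+1}] holds. -/
open MeasureTheory Filter Set

/-- Young's inequality for the conjugate exponents `(p + 1) / p` and `p + 1`. -/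
theorem rpow_mul_le_young {p a b : ℝ} (hp : 0 < p) (ha : 0 ≤ a) (hb : 0 ≤ b) :
    a ^ p * b ≤ p / (p + 1) * a ^ (p + 1) + b ^ (p + 1) / (p + 1) := by
  have hconj : ((p + 1) / p).HolderConjugate (p + 1) := by
    rw [Real.holderConjugate_iff]
    refine ⟨by rw [one_lt_div hp]; linarith, ?_⟩
    field_simp
  have h := Real.young_inequality_of_nonneg (Real.rpow_nonneg ha p) hb hconj
  rw [← Real.rpow_mul ha, mul_div_cancel₀ _ hp.ne'] at h
  calc a ^ p * b ≤ _ := h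
    _ = _ := by field_simp

theorem sum_partialSups_rpow_mul_sub_le {p : ℝ} (hp : 0 < p) {s : ℕ → ℝ} (hs : ∀ i, 0 ≤ s i)
    (n : ℕ) :
    ∑ i ∈ Finset.range n, partialSups s i ^ p * (s (i + 1) - s i) ≤
      partialSups s n ^ p * s n - p / (p + 1) * partialSups s n ^ (p + 1)
        - s 0 ^ (p + 1) / (p + 1) := by
  have hq : 0 < p + 1 := by linarith
  induction n with
  | zero =>
    have h : s 0 ^ (p + 1) = s 0 ^ p * s 0 := Real.rpow_add_one' (hs 0) hq.ne'
    simp only [Finset.range_zero, Finset.sum_empty, partialSups_zero, h]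
    apply le_of_eq
    field_simp
    ring
  | succ n ih =>
    have ha : 0 ≤ partialSups s n := (hs n).trans (le_partialSups s n)
    rw [Finset.sum_range_succ, partialSups_add_one]
    rcases le_total (s (n + 1)) (partialSups s n) with h | h
    · rw [sup_eq_left.mpr h]
      linarith
    · rw [sup_eq_right.mpr h]
      have hy := rpow_mul_le_young hp ha (hs (n + 1))
      have e : s (n + 1) ^ (p + 1) = s (n + 1) ^ p * s (n + 1) :=
        Real.rpow_add_one' (hs _) hq.ne'
      have e' : s (n + 1) ^ (p + 1) / (p + 1)
          = s (n + 1) ^ (p + 1) - p / (p + 1) * s (n + 1) ^ (p + 1) := by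
        field_simp
        ring
      linarith

/-- The pathwise form of the strengthened Doob maximal inequality in discrete time. -/
theorem partialSups_rpow_add_le {p : ℝ} (hp : 0 < p) {s : ℕ → ℝ} (hs : ∀ i, 0 ≤ s i) (n : ℕ) :
    partialSups s n ^ (p + 1) + (p + 1) / p * s 0 ^ (p + 1)
      + (p + 1) ^ 2 / p * ∑ i ∈ Finset.range n, partialSups s i ^ p * (s (i + 1) - s i)
      ≤ ((p + 1) / p) ^ (p + 1) * s n ^ (p + 1) := by
  have hq : 0 < p + 1 := by linarith
  have ha : 0 ≤ partialSups s n := (hs n).trans (le_partialSups s n)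
  set a := partialSups s n
  have hr : 0 < (p + 1) / p := by positivity
  have hy := rpow_mul_le_young hp ha (mul_nonneg hr.le (hs n))
  rw [Real.mul_rpow hr.le (hs n)] at hy
  have hsum := sum_partialSups_rpow_mul_sub_le hp hs n
  have h := mul_le_mul_of_nonneg_left hsum (by positivity : 0 ≤ (p + 1) ^ 2 / p)
  have hy' := mul_le_mul_of_nonneg_left hy (by positivity : 0 ≤ p + 1)
  have e1 : (p + 1) ^ 2 / p * (a ^ p * s n - p / (p + 1) * a ^ (p + 1) - s 0 ^ (p + 1) / (p + 1))
      = (p + 1) * (a ^ p * ((p + 1) / p * s n)) - (p + 1) * a ^ (p + 1)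
        - (p + 1) / p * s 0 ^ (p + 1) := by
    field_simp
  have e2 : (p + 1) * (p / (p + 1) * a ^ (p + 1)
        + ((p + 1) / p) ^ (p + 1) * s n ^ (p + 1) / (p + 1))
      = p * a ^ (p + 1) + ((p + 1) / p) ^ (p + 1) * s n ^ (p + 1) := by
    field_simp
  linarith

theorem MeasureTheory.Submartingale.integral_mul_sub_nonneg {Ω ι : Type*} [Preorder ι]
    {m0 : MeasurableSpace Ω} {μ : Measure Ω} [IsFiniteMeasure μ] {ℱ : Filtration ι m0}
    {X : ι → Ω → ℝ} (hX : Submartingale X ℱ μ) {s t : ι} (hst : s ≤ t) {g : Ω → ℝ}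
    (hg : StronglyMeasurable[ℱ s] g) (hg0 : 0 ≤ g) (hint : Integrable (g * (X t - X s)) μ) :
    0 ≤ ∫ ω, g ω * (X t ω - X s ω) ∂μ := by
  have hc := condExp_mul_of_stronglyMeasurable_left hg hint
    ((hX.integrable t).sub (hX.integrable s))
  have h0 := hX.condExp_sub_nonneg hst
  calc 0 ≤ ∫ ω, (μ[g * (X t - X s) | ℱ s]) ω ∂μ := by
        apply integral_nonneg_of_ae
        filter_upwards [hc, h0] with ω h1 h2
        rw [h1]
        exact mul_nonneg (hg0 ω) h2
    _ = _ := integral_condExp (ℱ.le s)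

/-- The strengthened Doob maximal inequality along an increasing sequence of times. -/
theorem MeasureTheory.Submartingale.integral_partialSups_rpow_add_le {Ω ι : Type*} [Preorder ι]
    {m0 : MeasurableSpace Ω} {μ : Measure Ω} [IsProbabilityMeasure μ] {ℱ : Filtration ι m0}
    {X : ι → Ω → ℝ} (hX : Submartingale X ℱ μ) (hX0 : ∀ t ω, 0 ≤ X t ω) {t : ℕ → ι}
    (ht : Monotone t) {x₀ : ℝ} (hx₀ : ∀ ω, X (t 0) ω = x₀) {p : ℝ} (hp : 0 < p) {n : ℕ}
    {B : Ω → ℝ} (hB : ∀ i ≤ n, ∀ ω, X (t i) ω ≤ B ω)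
    (hBint : Integrable (fun ω => B ω ^ (p + 1)) μ) :
    ∫ ω, partialSups (fun i => X (t i) ω) n ^ (p + 1) ∂μ + (p + 1) / p * x₀ ^ (p + 1)
      ≤ ((p + 1) / p) ^ (p + 1) * ∫ ω, X (t n) ω ^ (p + 1) ∂μ := by
  have hq : 0 < p + 1 := by linarith
  have hmeas (i : ℕ) :
      StronglyMeasurable[ℱ (t i)] (fun ω => partialSups (fun i => X (t i) ω) i) := by
    induction i with
    | zero => simpa using hX.stronglyAdapted (t 0)
    | succ i ih =>
      simp only [partialSups_add_one]
      exact continuous_sup.comp_stronglyMeasurable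
        ((ih.mono (ℱ.mono (ht i.le_succ))).prodMk (hX.stronglyAdapted _))
  have hXm (i : ι) : Measurable (X i) := ((hX.stronglyAdapted i).mono (ℱ.le i)).measurable
  have hSm (i : ℕ) : Measurable (fun ω => partialSups (fun i => X (t i) ω) i) :=
    ((hmeas i).mono (ℱ.le _)).measurable
  have hS0 (i : ℕ) (ω : Ω) : 0 ≤ partialSups (fun i => X (t i) ω) i :=
    (hX0 (t i) ω).trans (le_partialSups (fun i => X (t i) ω) i)
  have hSB (i : ℕ) (hi : i ≤ n) (ω : Ω) : partialSups (fun i => X (t i) ω) i ≤ B ω :=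
    partialSups_le _ _ _ fun j hj => hB j (hj.trans hi) ω
  have hB0 (ω : Ω) : 0 ≤ B ω := (hX0 _ ω).trans (hB 0 n.zero_le ω)
  have hSq : Integrable (fun ω => partialSups (fun i => X (t i) ω) n ^ (p + 1)) μ := by
    refine hBint.mono' ((hSm n).pow_const _).aestronglyMeasurable (.of_forall fun ω => ?_)
    rw [Real.norm_of_nonneg (Real.rpow_nonneg (hS0 n ω) _)]
    exact Real.rpow_le_rpow (hS0 n ω) (hSB n le_rfl ω) hq.le
  have hXq : Integrable (fun ω => X (t n) ω ^ (p + 1)) μ := by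
    refine hBint.mono' ((hXm _).pow_const _).aestronglyMeasurable (.of_forall fun ω => ?_)
    rw [Real.norm_of_nonneg (Real.rpow_nonneg (hX0 _ ω) _)]
    exact Real.rpow_le_rpow (hX0 _ ω) (hB n le_rfl ω) hq.le
  have hinc (i : ℕ) (hi : i < n) : Integrable (fun ω =>
      partialSups (fun i => X (t i) ω) i ^ p * (X (t (i + 1)) ω - X (t i) ω)) μ := by
    refine hBint.mono' (((hSm i).pow_const _).mul
      ((hXm _).sub (hXm _))).aestronglyMeasurable (.of_forall fun ω => ?_)
    rw [norm_mul, Real.norm_of_nonneg (Real.rpow_nonneg (hS0 i ω) _),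
      Real.rpow_add_one' (hB0 ω) hq.ne']
    refine mul_le_mul (Real.rpow_le_rpow (hS0 i ω) (hSB i hi.le ω) hp.le) ?_ (norm_nonneg _)
      (Real.rpow_nonneg (hB0 ω) _)
    rw [Real.norm_eq_abs, abs_le]
    have h1 := hB i hi.le ω
    have h2 := hB (i + 1) hi ω
    have h3 := hX0 (t i) ω
    have h4 := hX0 (t (i + 1)) ω
    constructor <;> linarith
  have hsum : Integrable (fun ω => ∑ i ∈ Finset.range n,
      partialSups (fun i => X (t i) ω) i ^ p * (X (t (i + 1)) ω - X (t i) ω)) μ :=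
    integrable_finsetSum _ fun i hi => hinc i (Finset.mem_range.mp hi)
  have hpos : 0 ≤ ∫ ω, ∑ i ∈ Finset.range n,
      partialSups (fun i => X (t i) ω) i ^ p * (X (t (i + 1)) ω - X (t i) ω) ∂μ := by
    rw [integral_finsetSum _ fun i hi => hinc i (Finset.mem_range.mp hi)]
    refine Finset.sum_nonneg fun i hi => ?_
    refine hX.integral_mul_sub_nonneg (g := fun ω => partialSups (fun i => X (t i) ω) i ^ p)
      (ht i.le_succ) ?_ (fun ω => Real.rpow_nonneg (hS0 i ω) _) (hinc i (Finset.mem_range.mp hi))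
    exact ((hmeas i).measurable.pow_const p).stronglyMeasurable
  have hle := integral_mono ((hSq.add (integrable_const ((p + 1) / p * x₀ ^ (p + 1)))).add
    (hsum.const_mul ((p + 1) ^ 2 / p))) (hXq.const_mul (((p + 1) / p) ^ (p + 1))) fun ω => by
      simpa only [Pi.add_apply, hx₀] using
        partialSups_rpow_add_le hp (s := fun i => X (t i) ω) (fun i => hX0 _ ω) n
  rw [integral_add' (hSq.add (integrable_const _)) (hsum.const_mul _),
    integral_add' hSq (integrable_const _), integral_const_mul ((p + 1) ^ 2 / p),
    integral_const_mul (((p + 1) / p) ^ (p + 1))] at hle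
  simp only [integral_const, probReal_univ, one_smul] at hle
  have := mul_nonneg (by positivity : 0 ≤ (p + 1) ^ 2 / p) hpos
  linarith

/-- The maxima of a continuous function over uniform grids converge to its supremum. -/
theorem tendsto_partialSups_grid {f : ℝ → ℝ} (hf : Continuous f) {T : ℝ} (hT : 0 < T) :
    Tendsto (fun n : ℕ => partialSups (fun i : ℕ => f (i * T / n)) n) atTop
      (nhds (⨆ s : Icc (0 : ℝ) T, f s)) := by
  obtain ⟨u, hu, hmax⟩ := isCompact_Icc.exists_isMaxOn (nonempty_Icc.mpr hT.le) hf.continuousOn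
  have : Nonempty (Icc (0 : ℝ) T) := ⟨⟨u, hu⟩⟩
  have hsup : ⨆ s : Icc (0 : ℝ) T, f s = f u :=
    le_antisymm (ciSup_le fun s => hmax s.2)
      (le_ciSup (f := fun s : Icc (0 : ℝ) T => f s)
        ⟨f u, by rintro _ ⟨s, rfl⟩; exact hmax s.2⟩ ⟨u, hu⟩)
  rw [hsup]
  have hlim : Tendsto (fun n : ℕ => f (⌊u / T * n⌋₊ * T / n)) atTop (nhds (f u)) := by
    have h := ((tendsto_nat_floor_mul_div_atTop (R := ℝ) (div_nonneg hu.1 hT.le)).comp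
      tendsto_natCast_atTop_atTop).mul_const T
    rw [div_mul_cancel₀ _ hT.ne'] at h
    refine (hf.tendsto u).comp (h.congr fun n => ?_)
    simp only [Function.comp_apply]
    ring
  refine tendsto_of_tendsto_of_tendsto_of_le_of_le' hlim tendsto_const_nhds
    (.of_forall fun n => ?_) ?_
  · refine le_partialSups_of_le (fun i : ℕ => f (i * T / n)) (Nat.floor_le_of_le ?_)
    exact mul_le_of_le_one_left n.cast_nonneg ((div_le_one hT).mpr hu.2)
  · filter_upwards [eventually_gt_atTop 0] with n hn
    refine partialSups_le _ _ _ fun i hi => hmax ⟨by positivity, ?_⟩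
    have hn' : (0 : ℝ) < n := Nat.cast_pos.mpr hn
    rw [div_le_iff₀ hn', mul_comm]
    exact mul_le_mul_of_nonneg_left (Nat.cast_le.mpr hi) hT.le

/-- **Generalization of Doob's maximal inequality.** Let `X` be a nonnegative
continuous sub-martingale started at the deterministic value `x₀ ≥ 0`, with running
maximum `M t = ⨆ s ∈ [0, t], X s`, and let `A` be the quadratic variation process
`[X,X]`.  Fix `p > 0` and assume `∫_0^T M_t ^ (2p) d[X,X]_t < ∞` almost surely, and
that `X_T ^ (p+1)` and `M_T ^ (p+1)` are integrable.  Then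
`E[M_T ^ (p+1)] + ((p+1)/p) * x₀ ^ (p+1) ≤ ((p+1)/p) ^ (p+1) * E[X_T ^ (p+1)]`. -/
theorem generalized_doob_maximal_inequality
    {Ω : Type*} {m0 : MeasurableSpace Ω} {μ : Measure Ω} [IsProbabilityMeasure μ]
    (ℱ : Filtration ℝ m0) (X : ℝ → Ω → ℝ)
    (hX : Submartingale X ℱ μ)
    (hXcont : ∀ ω, Continuous fun t => X t ω)
    (hXnonneg : ∀ t ω, 0 ≤ X t ω)
    (x₀ : ℝ) (hx₀ : 0 ≤ x₀) (hX0 : ∀ ω, X 0 ω = x₀)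
    (T : ℝ) (hT : 0 < T)
    (M : ℝ → Ω → ℝ) (hM : ∀ t ω, M t ω = ⨆ s : Set.Icc (0 : ℝ) t, X (s : ℝ) ω)
    -- `A` is the quadratic variation `[X,X]` of `X`:
    (A : ℝ → Ω → ℝ)
    (hAmono : ∀ ω, Monotone fun t => A t ω)
    (hAcont : ∀ ω, Continuous fun t => A t ω)
    (hAqv : ∀ t : ℝ, 0 ≤ t → TendstoInMeasure μ
      (fun n ω => ∑ i ∈ Finset.range (2 ^ n),
        (X (((i : ℝ) + 1) * t / 2 ^ n) ω - X ((i : ℝ) * t / 2 ^ n) ω) ^ 2)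
      atTop (fun ω => A t ω))
    (p : ℝ) (hp : 0 < p)
    -- `∫_0^T M_t ^ (2p) d[X,X]_t < ∞` almost surely:
    (hfin : ∀ᵐ ω ∂μ, ∫⁻ t in Set.Ioc (0 : ℝ) T, ENNReal.ofReal (M t ω ^ (2 * p))
      ∂(StieltjesFunction.measure
        ⟨fun t => A t ω, hAmono ω, fun _ => (hAcont ω).continuousWithinAt⟩) < ⊤)
    (hint₁ : Integrable (fun ω => X T ω ^ (p + 1)) μ)
    (hint₂ : Integrable (fun ω => M T ω ^ (p + 1)) μ) :
    (∫ ω, M T ω ^ (p + 1) ∂μ) + ((p + 1) / p) * x₀ ^ (p + 1)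
      ≤ ((p + 1) / p) ^ (p + 1) * ∫ ω, X T ω ^ (p + 1) ∂μ := by
  have hq : 0 < p + 1 := by linarith
  have hXM (ω : Ω) {s : ℝ} (hs : s ∈ Icc 0 T) : X s ω ≤ M T ω := by
    rw [hM]
    refine le_ciSup (f := fun s : Icc (0 : ℝ) T => X s ω) ?_ ⟨s, hs⟩
    have h := (isCompact_Icc (a := (0 : ℝ)) (b := T)).bddAbove_image (hXcont ω).continuousOn
    rwa [image_eq_range] at h
  have hgrid {n : ℕ} (hn : 0 < n) {i : ℕ} (hi : i ≤ n) : (i * T / n : ℝ) ∈ Icc 0 T := by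
    refine ⟨by positivity, ?_⟩
    rw [div_le_iff₀ (Nat.cast_pos.mpr hn), mul_comm]
    exact mul_le_mul_of_nonneg_left (Nat.cast_le.mpr hi) hT.le
  have hmeas (n k : ℕ) : Measurable (fun ω => partialSups (fun i : ℕ => X (i * T / n) ω) k) := by
    have hXm (t : ℝ) : Measurable (X t) := ((hX.stronglyAdapted t).mono (ℱ.le t)).measurable
    induction k with
    | zero => simpa using hXm _
    | succ k ih =>
      simp only [partialSups_add_one]
      exact ih.sup (hXm _)
  have hlim : Tendsto (fun n : ℕ => ∫ ω, partialSups (fun i : ℕ => X (i * T / n) ω) n ^ (p + 1) ∂μ)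
      atTop (nhds (∫ ω, M T ω ^ (p + 1) ∂μ)) := by
    refine tendsto_integral_filter_of_dominated_convergence _
      (.of_forall fun n => ((hmeas n n).pow_const _).aestronglyMeasurable) ?_ hint₂
      (.of_forall fun ω => ?_)
    · filter_upwards [eventually_gt_atTop 0] with n hn
      refine .of_forall fun ω => ?_
      have h0 : 0 ≤ partialSups (fun i : ℕ => X (i * T / n) ω) n :=
        (hXnonneg _ ω).trans (le_partialSups (fun i : ℕ => X (i * T / n) ω) n)
      rw [Real.norm_of_nonneg (Real.rpow_nonneg h0 _)]
      exact Real.rpow_le_rpow h0 (partialSups_le _ _ _ fun i hi => hXM ω (hgrid hn hi)) hq.le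
    · rw [hM]
      exact (tendsto_partialSups_grid (hXcont ω) hT).rpow_const (.inr hq.le)
  refine le_of_tendsto (hlim.add_const _) ?_
  filter_upwards [eventually_gt_atTop 0] with n hn
  have hn' : (n : ℝ) ≠ 0 := Nat.cast_ne_zero.mpr hn.ne'
  have h := hX.integral_partialSups_rpow_add_le hXnonneg (t := fun i : ℕ => (i * T / n : ℝ))
    (fun i j hij => by dsimp only; gcongr) (x₀ := x₀) (fun ω => by simp [hX0]) hp (n := n)
    (fun i hi ω => hXM ω (hgrid hn hi)) hint₂
  simpa only [mul_div_cancel_left₀ T hn'] using h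
end

section
/- Let X be a continuous martingale started at the deterministic value X_0 = x₀, with running maximum M_T = sup_{0 ≤ s ≤ T} X_s. Assume the integrability condition ∫_0^T M_t^2 d[X,X]_t < ∞ almost surely (and that X_T^2 and M_T^2 are integrable). Then E[M_T] ≤ √2 · (E[X_T^2])^{1/2}. -/
open MeasureTheory Filter Set

section DiscreteMartingale

variable {Ω : Type*} {m0 : MeasurableSpace Ω} {μ : Measure Ω}

/-- Increments of a square-integrable martingale are orthogonal to the past. -/
lemma MeasureTheory.Martingale.integral_mul_eq_s9 {ι : Type*} [Preorder ι] [IsFiniteMeasure μ]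
    {𝒢 : Filtration ι m0} {Y : ι → Ω → ℝ} (hY : Martingale Y 𝒢 μ) {i j : ι} (hij : i ≤ j)
    {Z : Ω → ℝ} (hZ : StronglyMeasurable[𝒢 i] Z) (hZ2 : MemLp Z 2 μ) (hYj : MemLp (Y j) 2 μ) :
    ∫ ω, Z ω * Y j ω ∂μ = ∫ ω, Z ω * Y i ω ∂μ := by
  have h := condExp_mul_of_stronglyMeasurable_left hZ (hZ2.integrable_mul hYj) (hY.integrable j)
  calc ∫ ω, Z ω * Y j ω ∂μ = ∫ ω, (μ[Z * Y j | 𝒢 i]) ω ∂μ := (integral_condExp (𝒢.le i)).symm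
    _ = ∫ ω, Z ω * Y i ω ∂μ := by
      refine integral_congr_ae ?_
      filter_upwards [h, hY.2 i j hij] with ω h₁ h₂
      rw [h₁, Pi.mul_apply, h₂]

lemma memLp_partialSups {p : ENNReal} {Y : ℕ → Ω → ℝ} (hY : ∀ k, MemLp (Y k) p μ) (n : ℕ) :
    MemLp (partialSups Y n) p μ := by
  induction n with
  | zero => simpa using hY 0
  | succ n ih => rw [partialSups_add_one]; exact ih.sup (hY _)

lemma MeasureTheory.StronglyAdapted.partialSups {𝒢 : Filtration ℕ m0} {Y : ℕ → Ω → ℝ}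
    (hY : StronglyAdapted 𝒢 Y) : StronglyAdapted 𝒢 (partialSups Y) := by
  intro n
  induction n with
  | zero => simpa using hY 0
  | succ n ih =>
    rw [partialSups_add_one]
    exact continuous_sup.comp_stronglyMeasurable
      ((ih.mono (𝒢.mono n.le_succ)).prodMk (hY (n + 1)))

/-- The mean-square drawdown of a square-integrable martingale is at most the variance of its
total increment. -/
lemma MeasureTheory.Martingale.integral_sq_partialSups_sub_le [IsFiniteMeasure μ]
    {𝒢 : Filtration ℕ m0} {Y : ℕ → Ω → ℝ} (hY : Martingale Y 𝒢 μ)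
    (hY2 : ∀ k, MemLp (Y k) 2 μ) (n : ℕ) :
    ∫ ω, (partialSups Y n ω - Y n ω) ^ 2 ∂μ ≤ ∫ ω, Y n ω ^ 2 ∂μ - ∫ ω, Y 0 ω ^ 2 ∂μ := by
  have hS := memLp_partialSups hY2
  have expand (n i : ℕ) : ∫ ω, (partialSups Y n ω - Y i ω) ^ 2 ∂μ =
      ∫ ω, partialSups Y n ω ^ 2 ∂μ - 2 * ∫ ω, partialSups Y n ω * Y i ω ∂μ
        + ∫ ω, Y i ω ^ 2 ∂μ := by
    have h₁ := (hS n).integrable_sq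
    have h₂ : Integrable (fun ω => 2 * (partialSups Y n ω * Y i ω)) μ :=
      ((hS n).integrable_mul (hY2 i)).const_mul 2
    rw [← integral_const_mul, ← integral_sub h₁ h₂,
      ← integral_add (by exact h₁.sub h₂) (hY2 i).integrable_sq]
    exact integral_congr_ae (.of_forall fun ω => by simp only; ring)
  induction n with
  | zero => simp
  | succ n ih =>
    have hcross := hY.integral_mul_eq_s9 n.le_succ (hY.1.partialSups n) (hS n) (hY2 (n + 1))
    have hle : ∫ ω, (partialSups Y (n + 1) ω - Y (n + 1) ω) ^ 2 ∂μ ≤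
        ∫ ω, (partialSups Y n ω - Y (n + 1) ω) ^ 2 ∂μ := by
      refine integral_mono ((hS (n + 1)).sub (hY2 (n + 1))).integrable_sq
        ((hS n).sub (hY2 (n + 1))).integrable_sq fun ω => ?_
      simp only [partialSups_add_one, Pi.sup_apply]
      rcases le_total (partialSups Y n ω) (Y (n + 1) ω) with h | h
      · simpa [sup_eq_right.2 h] using sq_nonneg _
      · rw [sup_eq_left.2 h]
    linarith [expand n n, expand n (n + 1)]

/-- The discrete-time maximal inequality `E[max Y] ^ 2 ≤ 2 * E[Y ^ 2]`. -/
lemma MeasureTheory.Martingale.sq_integral_partialSups_le [IsProbabilityMeasure μ]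
    {𝒢 : Filtration ℕ m0} {Y : ℕ → Ω → ℝ} (hY : Martingale Y 𝒢 μ)
    (hY2 : ∀ k, MemLp (Y k) 2 μ) (n : ℕ) :
    (∫ ω, partialSups Y n ω ∂μ) ^ 2 ≤ 2 * ∫ ω, Y n ω ^ 2 ∂μ := by
  have sq_le {f : Ω → ℝ} (hf : MemLp f 2 μ) : (∫ ω, f ω ∂μ) ^ 2 ≤ ∫ ω, f ω ^ 2 ∂μ := by
    have := ProbabilityTheory.variance_nonneg f μ
    rw [ProbabilityTheory.variance_eq_sub hf] at this
    simpa using this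
  have hS := memLp_partialSups hY2 n
  have h₁ := sq_le (hS.sub (hY2 n))
  have h₂ := sq_le (hY2 0)
  have h₃ := hY.integral_sq_partialSups_sub_le hY2 n
  have h₄ : ∫ ω, Y n ω ∂μ = ∫ ω, Y 0 ω ∂μ := by
    simpa using (hY.setIntegral_eq n.zero_le MeasurableSet.univ).symm
  simp only [Pi.sub_apply] at h₁
  rw [integral_sub (hS.integrable one_le_two) (hY.integrable n), h₄] at h₁
  nlinarith [sq_nonneg (∫ ω, partialSups Y n ω ∂μ - 2 * ∫ ω, Y 0 ω ∂μ)]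

end DiscreteMartingale

/-- The point of index `k` of the subdivision of `[0, T]` into `n + 1` equal intervals, frozen
at `T` once it is reached. -/
noncomputable def uniformGrid (T : ℝ) (n k : ℕ) : ℝ := min (k * (T / (n + 1))) T

section UniformGrid

variable {T : ℝ}

lemma uniformGrid_zero (hT : 0 ≤ T) (n : ℕ) : uniformGrid T n 0 = 0 := by
  simp [uniformGrid, hT]

lemma uniformGrid_last (n : ℕ) : uniformGrid T n (n + 1) = T := by
  have : (n + 1 : ℝ) ≠ 0 := by positivity
  simp [uniformGrid, mul_div_cancel₀ T this]

lemma uniformGrid_mem_Icc (hT : 0 ≤ T) (n k : ℕ) : uniformGrid T n k ∈ Icc 0 T :=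
  ⟨le_min (by positivity) hT, min_le_right _ _⟩

lemma uniformGrid_mono (hT : 0 ≤ T) (n : ℕ) : Monotone (uniformGrid T n) := by
  intro i j hij
  unfold uniformGrid
  gcongr

lemma exists_uniformGrid_near (hT : 0 < T) {s : ℝ} (hs : s ∈ Icc 0 T) (n : ℕ) :
    ∃ k ≤ n + 1, |uniformGrid T n k - s| ≤ T / (n + 1) := by
  have hd : 0 < T / (n + 1) := by positivity
  have h₀ : 0 ≤ s / (T / (n + 1)) := div_nonneg hs.1 hd.le
  have h₁ : (⌊s / (T / (n + 1))⌋₊ : ℝ) * (T / (n + 1)) ≤ s :=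
    (le_div_iff₀ hd).1 (Nat.floor_le h₀)
  have h₂ : s < ((⌊s / (T / (n + 1))⌋₊ : ℝ) + 1) * (T / (n + 1)) :=
    (div_lt_iff₀ hd).1 (Nat.lt_floor_add_one _)
  refine ⟨⌊s / (T / (n + 1))⌋₊, ?_, ?_⟩
  · refine Nat.floor_le_of_le ?_
    rw [div_le_iff₀ hd]
    push_cast
    rw [mul_div_cancel₀ T (by positivity)]
    exact hs.2
  · rw [uniformGrid, min_eq_left (h₁.trans hs.2), abs_le]
    constructor <;> linarith

/-- For a continuous function, maxima over finer and finer uniform grids converge to the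
supremum over the interval. -/
lemma tendsto_partialSups_uniformGrid (hT : 0 < T) {f : ℝ → ℝ} (hf : Continuous f) :
    Tendsto (fun n : ℕ => partialSups (fun k => f (uniformGrid T n k)) (n + 1)) atTop
      (nhds (⨆ s : Icc (0 : ℝ) T, f s)) := by
  obtain ⟨s, hs, hmax⟩ := isCompact_Icc.exists_isMaxOn (nonempty_Icc.2 hT.le) hf.continuousOn
  have hsup : ⨆ s : Icc (0 : ℝ) T, f s = f s := by
    have : Nonempty (Icc (0 : ℝ) T) := ⟨⟨s, hs⟩⟩
    refine le_antisymm (ciSup_le fun r => hmax r.2) ?_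
    exact le_ciSup (f := fun r : Icc (0 : ℝ) T => f r)
      ⟨f s, by rintro _ ⟨r, rfl⟩; exact hmax r.2⟩ ⟨s, hs⟩
  choose k hk hnear using exists_uniformGrid_near hT hs
  have hmesh : Tendsto (fun n : ℕ => T / ((n : ℝ) + 1)) atTop (nhds 0) := by
    simpa [div_eq_mul_inv] using (tendsto_one_div_add_atTop_nhds_zero_nat (𝕜 := ℝ)).const_mul T
  have hgrid : Tendsto (fun n => uniformGrid T n (k n)) atTop (nhds s) := by
    rw [tendsto_iff_dist_tendsto_zero]
    exact squeeze_zero (fun _ => dist_nonneg) (fun n => by rw [Real.dist_eq]; exact hnear n) hmesh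
  rw [hsup]
  refine tendsto_of_tendsto_of_tendsto_of_le_of_le ((hf.tendsto s).comp hgrid)
    tendsto_const_nhds (fun n => ?_) (fun n => ?_)
  · exact le_partialSups_of_le (fun k => f (uniformGrid T n k)) (hk n)
  · exact partialSups_le _ _ _ fun j _ => hmax (uniformGrid_mem_Icc hT.le n j)

end UniformGrid

/-- Let `X` be a continuous martingale started at the deterministic value `x₀`, with
running maximum `M t = ⨆ s ∈ [0, t], X s`, and let `A` be the quadratic variation
process `[X,X]`.  Assume `∫_0^T M_t ^ 2 d[X,X]_t < ∞` almost surely, and that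
`X_T ^ 2` and `M_T ^ 2` are integrable.  Then
`E[M_T] ≤ √2 * (E[X_T ^ 2]) ^ (1/2)`. -/
theorem expectation_max_le_sqrt_two
    {Ω : Type*} {m0 : MeasurableSpace Ω} {μ : Measure Ω} [IsProbabilityMeasure μ]
    (ℱ : Filtration ℝ m0) (X : ℝ → Ω → ℝ)
    (hX : Martingale X ℱ μ)
    (hXcont : ∀ ω, Continuous fun t => X t ω)
    (x₀ : ℝ) (hX0 : ∀ ω, X 0 ω = x₀)
    (T : ℝ) (hT : 0 < T)
    (M : ℝ → Ω → ℝ) (hM : ∀ t ω, M t ω = ⨆ s : Set.Icc (0 : ℝ) t, X (s : ℝ) ω)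
    -- `A` is the quadratic variation `[X,X]` of `X`:
    (A : ℝ → Ω → ℝ)
    (hAmono : ∀ ω, Monotone fun t => A t ω)
    (hAcont : ∀ ω, Continuous fun t => A t ω)
    (hAqv : ∀ t : ℝ, 0 ≤ t → TendstoInMeasure μ
      (fun n ω => ∑ i ∈ Finset.range (2 ^ n),
        (X (((i : ℝ) + 1) * t / 2 ^ n) ω - X ((i : ℝ) * t / 2 ^ n) ω) ^ 2)
      atTop (fun ω => A t ω))
    -- `∫_0^T M_t ^ 2 d[X,X]_t < ∞` almost surely:
    (hfin : ∀ᵐ ω ∂μ, ∫⁻ t in Set.Ioc (0 : ℝ) T, ENNReal.ofReal (M t ω ^ 2)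
      ∂(StieltjesFunction.measure
        ⟨fun t => A t ω, hAmono ω, fun _ => (hAcont ω).continuousWithinAt⟩) < ⊤)
    (hint₁ : Integrable (fun ω => X T ω ^ 2) μ)
    (hint₂ : Integrable (fun ω => M T ω ^ 2) μ) :
    ∫ ω, M T ω ∂μ ≤ Real.sqrt 2 * (∫ ω, X T ω ^ 2 ∂μ) ^ ((1 : ℝ) / 2) := by
  by_cases hMint : Integrable (M T) μ
  swap
  · rw [integral_undef hMint]
    positivity
  have hXT : MemLp (X T) 2 μ :=
    (memLp_two_iff_integrable_sq (hX.integrable T).aestronglyMeasurable).2 hint₁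
  have hX2 : ∀ t ≤ T, MemLp (X t) 2 μ := fun t ht =>
    (memLp_congr_ae (hX.2 t T ht)).1 (hXT.condExp one_le_two)
  have hgrid (n : ℕ) : (∫ ω, partialSups (fun k => X (uniformGrid T n k) ω) (n + 1) ∂μ) ^ 2
      ≤ 2 * ∫ ω, X T ω ^ 2 ∂μ := by
    let 𝒢 : Filtration ℕ m0 :=
      ⟨fun k => ℱ (uniformGrid T n k), fun _ _ h => ℱ.mono (uniformGrid_mono hT.le n h),
        fun k => ℱ.le _⟩
    have hY : Martingale (fun k => X (uniformGrid T n k)) 𝒢 μ :=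
      ⟨fun k => hX.1 _, fun i j h => hX.2 _ _ (uniformGrid_mono hT.le n h)⟩
    simpa only [Pi.partialSups_apply, uniformGrid_last] using
      hY.sq_integral_partialSups_le (fun k => hX2 _ (uniformGrid_mem_Icc hT.le n k).2) (n + 1)
  have hlim : Tendsto
      (fun n : ℕ => ∫ ω, partialSups (fun k => X (uniformGrid T n k) ω) (n + 1) ∂μ) atTop
      (nhds (∫ ω, M T ω ∂μ)) := by
    refine tendsto_integral_of_dominated_convergence (fun ω => |x₀| + |M T ω|) (fun n => ?_)
      ((integrable_const _).add hMint.abs) (fun n => .of_forall fun ω => ?_) (.of_forall fun ω => ?_)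
    · have := (memLp_partialSups (fun k => hX2 _ (uniformGrid_mem_Icc hT.le n k).2) (n + 1)).1
      simpa only [← Pi.partialSups_apply] using this
    · have hlow : x₀ ≤ partialSups (fun k => X (uniformGrid T n k) ω) (n + 1) := by
        have := le_partialSups_of_le (fun k => X (uniformGrid T n k) ω) (Nat.zero_le (n + 1))
        simpa only [uniformGrid_zero hT.le, hX0] using this
      have hbdd : BddAbove (range fun s : Icc (0 : ℝ) T => X s ω) := by
        simpa only [image_eq_range] using
          (isCompact_Icc (a := (0 : ℝ)) (b := T)).bddAbove_image (hXcont ω).continuousOn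
      have hup : partialSups (fun k => X (uniformGrid T n k) ω) (n + 1) ≤ M T ω := by
        rw [hM]
        exact partialSups_le _ _ _ fun j _ =>
          le_ciSup hbdd ⟨uniformGrid T n j, uniformGrid_mem_Icc hT.le n j⟩
      rw [Real.norm_eq_abs, abs_le]
      constructor
      · linarith [neg_abs_le x₀, abs_nonneg (M T ω)]
      · linarith [le_abs_self (M T ω), abs_nonneg x₀]
    · rw [hM]
      exact tendsto_partialSups_uniformGrid hT (hXcont ω)
  have hsq : (∫ ω, M T ω ∂μ) ^ 2 ≤ 2 * ∫ ω, X T ω ^ 2 ∂μ := le_of_tendsto' (hlim.pow 2) hgrid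
  rw [← Real.sqrt_eq_rpow, ← Real.sqrt_mul zero_le_two]
  exact Real.le_sqrt_of_sq_le hsq
end

section
/- Let X be a continuous martingale started at X_0 = 0, with running maximum M_T = sup_{0 ≤ s ≤ T} X_s. Assume the integrability condition ∫_0^T M_t^2 d[X,X]_t < ∞ almost surely (and that X_T^2 and M_T^2 are integrable). Then E[M_T] ≤ (E[X_T^2])^{1/2}; that is, the expectation of the running maximum is bounded by the standard deviation of X_T. -/
open MeasureTheory Filter Set

open scoped Topology

/-- The running maximum of a square-integrable process is square-integrable. -/
lemma memLp_two_partialSups {Ω : Type*} {m0 : MeasurableSpace Ω} {μ : Measure Ω}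
    {Y : ℕ → Ω → ℝ} (hY : ∀ k, MemLp (Y k) 2 μ) (n : ℕ) :
    MemLp (fun ω => partialSups (fun k => Y k ω) n) 2 μ := by
  induction n with
  | zero => simpa using hY 0
  | succ n ih =>
    simp only [partialSups_add_one]
    exact MemLp.sup ih (hY (n + 1))

/-- The running maximum of an adapted process is adapted. -/
lemma stronglyMeasurable_partialSups {Ω : Type*} {m0 : MeasurableSpace Ω} {𝒢 : Filtration ℕ m0}
    {Y : ℕ → Ω → ℝ} (hY : StronglyAdapted 𝒢 Y) (n : ℕ) :
    StronglyMeasurable[𝒢 n] (fun ω => partialSups (fun k => Y k ω) n) := by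
  induction n with
  | zero => simpa using hY 0
  | succ n ih =>
    simp only [partialSups_add_one]
    exact @StronglyMeasurable.sup _ _ _ _ (𝒢 (n + 1)) _ _ _ (ih.mono (𝒢.mono n.le_succ)) (hY (n + 1))

/-- The increments of a martingale are orthogonal to the past. -/
lemma integral_mul_martingale_succ {Ω : Type*} {m0 : MeasurableSpace Ω} {μ : Measure Ω}
    [IsFiniteMeasure μ] {𝒢 : Filtration ℕ m0} {Y : ℕ → Ω → ℝ} (hY : Martingale Y 𝒢 μ) {n : ℕ}
    {f : Ω → ℝ} (hf : StronglyMeasurable[𝒢 n] f)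
    (hfY : Integrable (fun ω => f ω * Y (n + 1) ω) μ) :
    ∫ ω, f ω * Y (n + 1) ω ∂μ = ∫ ω, f ω * Y n ω ∂μ := by
  rw [← integral_condExp (𝒢.le n)]
  refine integral_congr_ae ?_
  have h := condExp_mul_of_stronglyMeasurable_left hf hfY (hY.integrable (n + 1))
  filter_upwards [h, hY.condExp_ae_eq n.le_succ] with ω h₁ h₂
  exact h₁.trans (by rw [Pi.mul_apply]; exact congrArg (f ω * ·) h₂)

/-- The second moment of the drawdown of a discrete-time martingale started at `0` is bounded by
the second moment of the martingale. -/
lemma integral_sq_drawdown_le {Ω : Type*} {m0 : MeasurableSpace Ω} {μ : Measure Ω}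
    [IsFiniteMeasure μ] {𝒢 : Filtration ℕ m0} {Y : ℕ → Ω → ℝ} (hY : Martingale Y 𝒢 μ)
    (hY2 : ∀ k, MemLp (Y k) 2 μ) (n : ℕ) :
    ∫ ω, (partialSups (fun k => Y k ω) n - Y n ω) ^ 2 ∂μ ≤ ∫ ω, Y n ω ^ 2 ∂μ := by
  induction n with
  | zero =>
    simp only [partialSups_zero, sub_self]
    exact integral_mono_of_nonneg (ae_of_all _ fun _ => by simp) (hY2 0).integrable_sq
      (ae_of_all _ fun ω => by simpa using sq_nonneg (Y 0 ω))
  | succ n ih =>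
    set S : Ω → ℝ := fun ω => partialSups (fun k => Y k ω) n with hS
    have hS2 : MemLp S 2 μ := memLp_two_partialSups hY2 n
    have hSY (k : ℕ) : Integrable (fun ω => S ω * Y k ω) μ := hS2.integrable_mul (hY2 k)
    have hexp (k : ℕ) : ∫ ω, (S ω - Y k ω) ^ 2 ∂μ
        = ∫ ω, S ω ^ 2 ∂μ - 2 * ∫ ω, S ω * Y k ω ∂μ + ∫ ω, Y k ω ^ 2 ∂μ := by
      have hdiff : Integrable (fun ω => S ω ^ 2 - 2 * (S ω * Y k ω)) μ :=
        hS2.integrable_sq.sub ((hSY k).const_mul 2)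
      rw [← integral_const_mul, ← integral_sub hS2.integrable_sq ((hSY k).const_mul 2),
        ← integral_add hdiff (hY2 k).integrable_sq]
      exact integral_congr_ae (ae_of_all _ fun ω => by ring)
    have horth := integral_mul_martingale_succ hY (stronglyMeasurable_partialSups hY.1 n)
      (hSY (n + 1))
    have hstep : ∫ ω, (partialSups (fun k => Y k ω) (n + 1) - Y (n + 1) ω) ^ 2 ∂μ
        ≤ ∫ ω, (S ω - Y (n + 1) ω) ^ 2 ∂μ := by
      refine integral_mono_of_nonneg (ae_of_all _ fun _ => sq_nonneg _)
        (hS2.sub (hY2 (n + 1))).integrable_sq (ae_of_all _ fun ω => ?_)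
      simp only [partialSups_add_one]
      rcases le_total (S ω) (Y (n + 1) ω) with h | h
      · simp only [hS] at h
        rw [sup_of_le_right h]
        simpa using sq_nonneg _
      · simp only [hS] at h
        rw [sup_of_le_left h]
    have h₁ := hexp n
    have h₂ := hexp (n + 1)
    simp only [hS] at *
    linarith

/-- The expected running maximum of a centered square-integrable discrete-time martingale is
bounded by its standard deviation. -/
lemma integral_partialSups_le {Ω : Type*} {m0 : MeasurableSpace Ω} {μ : Measure Ω}
    [IsProbabilityMeasure μ] {𝒢 : Filtration ℕ m0} {Y : ℕ → Ω → ℝ} (hY : Martingale Y 𝒢 μ)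
    (hY2 : ∀ k, MemLp (Y k) 2 μ) (hY0 : ∀ k, ∫ ω, Y k ω ∂μ = 0) (n : ℕ) :
    ∫ ω, partialSups (fun k => Y k ω) n ∂μ ≤ √(∫ ω, Y n ω ^ 2 ∂μ) := by
  have hS2 := memLp_two_partialSups hY2 n
  have hD2 : MemLp (fun ω => partialSups (fun k => Y k ω) n - Y n ω) 2 μ := hS2.sub (hY2 n)
  have hD : ∫ ω, partialSups (fun k => Y k ω) n ∂μ
      = ∫ ω, (partialSups (fun k => Y k ω) n - Y n ω) ∂μ := by
    rw [integral_sub (hS2.integrable one_le_two) ((hY2 n).integrable one_le_two), hY0, sub_zero]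
  rw [hD]
  refine Real.le_sqrt_of_sq_le (le_trans ?_ (integral_sq_drawdown_le hY hY2 n))
  have := ProbabilityTheory.variance_eq_sub hD2
  have := ProbabilityTheory.variance_nonneg
    (fun ω => partialSups (fun k => Y k ω) n - Y n ω) μ
  simp only [Pi.pow_apply] at *
  linarith

/-- Sampling a martingale along a monotone sequence of times gives a martingale. -/
lemma martingale_comp_monotone {Ω ι κ : Type*} [Preorder ι] [Preorder κ] {m0 : MeasurableSpace Ω}
    {μ : Measure Ω} {ℱ : Filtration ι m0} {X : ι → Ω → ℝ} (hX : Martingale X ℱ μ) {τ : κ → ι}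
    (hτ : Monotone τ) :
    Martingale (fun k => X (τ k))
      (⟨fun k => ℱ (τ k), fun _ _ h => ℱ.mono (hτ h), fun _ => ℱ.le _⟩ : Filtration κ m0) μ :=
  ⟨fun _ => hX.1 _, fun _ _ h => hX.2 _ _ (hτ h)⟩

/-- The maximum of a continuous function over an equidistant grid of `[0, T]` converges to its
supremum over `[0, T]` as the grid gets finer. -/
lemma tendsto_partialSups_grid_s10 {x : ℝ → ℝ} (hx : Continuous x) {T : ℝ} (hT : 0 < T) :
    Tendsto (fun N : ℕ => partialSups (fun k : ℕ => x (min (k * T / N) T)) N) atTop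
      (𝓝 (⨆ s : Set.Icc (0 : ℝ) T, x s)) := by
  have hbdd : BddAbove (range fun s : Set.Icc (0 : ℝ) T => x s) :=
    isCompact_range (by fun_prop) |>.bddAbove
  obtain ⟨s, ⟨hs0, hsT⟩, hs⟩ :=
    isCompact_Icc.exists_isMaxOn (nonempty_Icc.2 hT.le) hx.continuousOn
  have : Nonempty (Set.Icc (0 : ℝ) T) := ⟨⟨s, hs0, hsT⟩⟩
  have hsup : ⨆ s : Set.Icc (0 : ℝ) T, x s = x s :=
    le_antisymm (ciSup_le fun t => hs t.2) (le_ciSup hbdd ⟨s, hs0, hsT⟩)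
  have hgrid : Tendsto (fun N : ℕ => x (min (⌊s / T * N⌋₊ * T / N) T)) atTop (𝓝 (x s)) := by
    refine (hx.tendsto s).comp ?_
    have h := ((tendsto_nat_floor_mul_div_atTop (div_nonneg hs0 hT.le)).comp
      (tendsto_natCast_atTop_atTop (R := ℝ))).mul_const T
    rw [div_mul_cancel₀ _ hT.ne'] at h
    have h' := h.min (tendsto_const_nhds (x := T))
    rw [min_eq_left hsT] at h'
    refine h'.congr fun N => ?_
    simp only [Function.comp_apply]
    rw [div_mul_eq_mul_div]
  rw [hsup]
  refine tendsto_of_tendsto_of_tendsto_of_le_of_le hgrid tendsto_const_nhds (fun N => ?_)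
    (fun N => ?_)
  · refine le_partialSups_of_le (fun k : ℕ => x (min (k * T / N) T)) (Nat.floor_le_of_le ?_)
    exact mul_le_of_le_one_left N.cast_nonneg ((div_le_one hT).2 hsT)
  · exact partialSups_le _ _ _ fun k _ => hs ⟨le_min (by positivity) hT.le, min_le_right _ _⟩

/-- Let `X` be a continuous martingale started at `0`, with
running maximum `M t = ⨆ s ∈ [0, t], X s`, and let `A` be the quadratic variation
process `[X,X]`.  Assume `∫_0^T M_t ^ 2 d[X,X]_t < ∞` almost surely, and that
`X_T ^ 2` and `M_T ^ 2` are integrable.  Then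
`E[M_T] ≤ (E[X_T ^ 2]) ^ (1/2)`: the expectation of the running maximum is bounded
by the standard deviation of `X_T`. -/
theorem expectation_max_le_stddev
    {Ω : Type*} {m0 : MeasurableSpace Ω} {μ : Measure Ω} [IsProbabilityMeasure μ]
    (ℱ : Filtration ℝ m0) (X : ℝ → Ω → ℝ)
    (hX : Martingale X ℱ μ)
    (hXcont : ∀ ω, Continuous fun t => X t ω)
    (hX0 : ∀ ω, X 0 ω = 0)
    (T : ℝ) (hT : 0 < T)
    (M : ℝ → Ω → ℝ) (hM : ∀ t ω, M t ω = ⨆ s : Set.Icc (0 : ℝ) t, X (s : ℝ) ω)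
    -- `A` is the quadratic variation `[X,X]` of `X`:
    (A : ℝ → Ω → ℝ)
    (hAmono : ∀ ω, Monotone fun t => A t ω)
    (hAcont : ∀ ω, Continuous fun t => A t ω)
    (hAqv : ∀ t : ℝ, 0 ≤ t → TendstoInMeasure μ
      (fun n ω => ∑ i ∈ Finset.range (2 ^ n),
        (X (((i : ℝ) + 1) * t / 2 ^ n) ω - X ((i : ℝ) * t / 2 ^ n) ω) ^ 2)
      atTop (fun ω => A t ω))
    -- `∫_0^T M_t ^ 2 d[X,X]_t < ∞` almost surely:
    (hfin : ∀ᵐ ω ∂μ, ∫⁻ t in Set.Ioc (0 : ℝ) T, ENNReal.ofReal (M t ω ^ 2)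
      ∂(StieltjesFunction.measure
        ⟨fun t => A t ω, hAmono ω, fun _ => (hAcont ω).continuousWithinAt⟩) < ⊤)
    (hint₁ : Integrable (fun ω => X T ω ^ 2) μ)
    (hint₂ : Integrable (fun ω => M T ω ^ 2) μ) :
    ∫ ω, M T ω ∂μ ≤ (∫ ω, X T ω ^ 2 ∂μ) ^ ((1 : ℝ) / 2) := by
  have hXT : MemLp (X T) 2 μ := (memLp_two_iff_integrable_sq
    ((hX.stronglyMeasurable T).mono (ℱ.le T)).aestronglyMeasurable).2 hint₁
  have hX2 (t : ℝ) (ht : t ≤ T) : MemLp (X t) 2 μ :=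
    (memLp_congr_ae (hX.condExp_ae_eq ht)).1 (hXT.condExp one_le_two)
  have hXmean (t : ℝ) (ht : 0 ≤ t) : ∫ ω, X t ω ∂μ = 0 := by
    rw [← integral_condExp (ℱ.le 0), integral_congr_ae (hX.condExp_ae_eq ht)]
    simp [hX0]
  rw [← Real.sqrt_eq_rpow]
  by_cases hMint : Integrable (M T) μ
  swap
  · rw [integral_undef hMint]
    positivity
  have hτ0 (N k : ℕ) : 0 ≤ min (k * T / N) T := le_min (by positivity) hT.le
  set S : ℕ → Ω → ℝ := fun N ω => partialSups (fun k : ℕ => X (min (k * T / N) T) ω) N with hS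
  have hS2 (N : ℕ) : MemLp (S N) 2 μ := memLp_two_partialSups (fun k => hX2 _ (min_le_right _ _)) N
  have hSM (N : ℕ) (ω : Ω) : S N ω ≤ M T ω := by
    rw [hM]
    have hbdd : BddAbove (range fun s : Set.Icc (0 : ℝ) T => X s ω) :=
      isCompact_range ((hXcont ω).comp continuous_subtype_val) |>.bddAbove
    exact partialSups_le _ _ _ fun k _ => le_ciSup hbdd ⟨_, hτ0 N k, min_le_right _ _⟩
  have hS0 (N : ℕ) (ω : Ω) : 0 ≤ S N ω := by
    refine le_trans ?_ (le_partialSups_of_le _ N.zero_le)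
    simp [hT.le, hX0]
  have hlim : Tendsto (fun N => ∫ ω, S N ω ∂μ) atTop (𝓝 (∫ ω, M T ω ∂μ)) := by
    refine tendsto_integral_of_dominated_convergence (M T) (fun N => (hS2 N).1) hMint
      (fun N => ae_of_all _ fun ω => ?_) (ae_of_all _ fun ω => ?_)
    · rw [Real.norm_of_nonneg (hS0 N ω)]
      exact hSM N ω
    · rw [hM]
      exact tendsto_partialSups_grid_s10 (hXcont ω) hT
  refine le_of_tendsto hlim ((eventually_gt_atTop 0).mono fun N hN => ?_)
  have hmono : Monotone fun k : ℕ => min (k * T / N) T := fun i j hij => by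
    dsimp only
    gcongr
  have h := integral_partialSups_le (martingale_comp_monotone hX hmono)
    (fun k => hX2 _ (min_le_right _ _)) (fun k => hXmean _ (hτ0 N k)) N
  have hN' : (N : ℝ) ≠ 0 := by positivity
  rwa [mul_div_cancel_left₀ T hN', min_self] at h
end
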